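/- Let a, b > 0 and δ ∈ ℝ, and let f : ℝ² → ℝ be defined by f(x,y) = δ if x²/a² + y²/b² ≤ 1 and f(x,y) = 0 otherwise (the attenuation function of the axis-aligned ellipse centered at the origin with semi-axes a, b and attenuation δ). Then for all t, θ ∈ ℝ: Rf(t,θ) = δ · 2ab·√(b² sin² θ + a² cos² θ − t²)/(b² sin² θ + a² cos² θ) if t² ≤ b² sin² θ + a² cos² θ, and Rf(t,θ) = 0 otherwise. -/

import Mathlib

open Real MeasureTheory

/-- The Radon transform of `f : ℝ² → ℝ` (in curried form):
`Rf(t,θ) = ∫ s, f(t cos θ − s sin θ, t sin θ + s cos θ)`. -/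
noncomputable def radonTransform (f : ℝ → ℝ → ℝ) (t θ : ℝ) : ℝ :=
  ∫ s : ℝ, f (t * Real.cos θ - s * Real.sin θ) (t * Real.sin θ + s * Real.cos θ)

theorem ellipse_width_sq_pos {a b : ℝ} (ha : 0 < a) (hb : 0 < b) {c n : ℝ}
    (h : n ^ 2 + c ^ 2 = 1) : 0 < b ^ 2 * n ^ 2 + a ^ 2 * c ^ 2 := by
  rcases eq_or_ne n 0 with rfl | hn
  · have hc : c ^ 2 = 1 := by simpa using h
    rw [hc]; positivity
  · positivity

/-- A point of the line `l_{t,θ}` lies in the ellipse iff its parameter `s` satisfies a quadratic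
inequality, written here with the square completed. -/
theorem ellipse_line_iff {a b : ℝ} (ha : 0 < a) (hb : 0 < b) {t s c n : ℝ}
    (h : n ^ 2 + c ^ 2 = 1) :
    (t * c - s * n) ^ 2 / a ^ 2 + (t * n + s * c) ^ 2 / b ^ 2 ≤ 1 ↔
      ((b ^ 2 * n ^ 2 + a ^ 2 * c ^ 2) * s + t * n * c * (a ^ 2 - b ^ 2)) ^ 2 ≤
        (a * b) ^ 2 * (b ^ 2 * n ^ 2 + a ^ 2 * c ^ 2 - t ^ 2) := by
  have hQ := ellipse_width_sq_pos ha hb h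
  have key : (b ^ 2 * n ^ 2 + a ^ 2 * c ^ 2) *
        ((t * c - s * n) ^ 2 * b ^ 2 + a ^ 2 * (t * n + s * c) ^ 2 - a ^ 2 * b ^ 2) =
      ((b ^ 2 * n ^ 2 + a ^ 2 * c ^ 2) * s + t * n * c * (a ^ 2 - b ^ 2)) ^ 2 -
        (a * b) ^ 2 * (b ^ 2 * n ^ 2 + a ^ 2 * c ^ 2 - t ^ 2) := by
    linear_combination t ^ 2 * a ^ 2 * b ^ 2 * (n ^ 2 + c ^ 2 + 1) * h
  rw [div_add_div _ _ (by positivity) (by positivity), div_le_one (by positivity),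
    ← sub_nonpos, ← sub_nonpos (b := (a * b) ^ 2 * _), ← key]
  constructor
  · exact fun hs => mul_nonpos_of_nonneg_of_nonpos hQ.le hs
  · exact fun hs => nonpos_of_mul_nonpos_right hs hQ

/-- The integral of a multiple of the indicator of `{s | |q s + p| ≤ r}`. -/
theorem integral_ite_abs_affine_le {q r : ℝ} (hq : 0 < q) (hr : 0 ≤ r) (p δ : ℝ) :
    ∫ s : ℝ, (if |q * s + p| ≤ r then δ else 0) = δ * (2 * r) / q := by
  have hset : (fun s : ℝ => if |q * s + p| ≤ r then δ else 0) =
      (Set.Icc ((-r - p) / q) ((r - p) / q)).indicator fun _ => δ := by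
    ext s
    simp only [Set.indicator_apply, Set.mem_Icc, div_le_iff₀ hq, le_div_iff₀ hq, abs_le]
    congr 1
    apply propext
    constructor <;> rintro ⟨h₁, h₂⟩ <;> constructor <;> linarith
  have hle : (-r - p) / q ≤ (r - p) / q := by gcongr; linarith
  rw [hset, integral_indicator measurableSet_Icc, setIntegral_const, Real.volume_real_Icc_of_le hle,
    smul_eq_mul]
  ring

/-- Radon transform of the attenuation function of an axis-aligned ellipse centered
at the origin with semi-axes `a`, `b` and attenuation `δ`. -/
theorem radon_ellipse_centered (a b δ : ℝ) (ha : 0 < a) (hb : 0 < b)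
    (f : ℝ → ℝ → ℝ)
    (hf : ∀ x y : ℝ, f x y = if x ^ 2 / a ^ 2 + y ^ 2 / b ^ 2 ≤ 1 then δ else 0) :
    ∀ t θ : ℝ,
      radonTransform f t θ =
        if t ^ 2 ≤ b ^ 2 * Real.sin θ ^ 2 + a ^ 2 * Real.cos θ ^ 2
        then δ * (2 * a * b *
            Real.sqrt (b ^ 2 * Real.sin θ ^ 2 + a ^ 2 * Real.cos θ ^ 2 - t ^ 2)) /
          (b ^ 2 * Real.sin θ ^ 2 + a ^ 2 * Real.cos θ ^ 2)
        else 0 := by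
  intro t θ
  have h := Real.sin_sq_add_cos_sq θ
  simp only [radonTransform, hf, ellipse_line_iff ha hb h]
  have hQ := ellipse_width_sq_pos ha hb h
  set Q := b ^ 2 * Real.sin θ ^ 2 + a ^ 2 * Real.cos θ ^ 2
  split_ifs with ht
  · have hd : 0 ≤ Q - t ^ 2 := sub_nonneg.2 ht
    have hr : 0 ≤ a * b * √(Q - t ^ 2) := by positivity
    have hsq : (a * b) ^ 2 * (Q - t ^ 2) = (a * b * √(Q - t ^ 2)) ^ 2 := by
      rw [mul_pow _ √_, Real.sq_sqrt hd]
    simp only [hsq, sq_le_sq, abs_of_nonneg hr]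
    rw [integral_ite_abs_affine_le hQ hr]
    ring
  · have hneg : (a * b) ^ 2 * (Q - t ^ 2) < 0 :=
      mul_neg_of_pos_of_neg (by positivity) (by linarith)
    simp [fun s : ℝ =>
      not_le.2 (hneg.trans_le (sq_nonneg (Q * s + t * Real.sin θ * Real.cos θ * (a ^ 2 - b ^ 2))))]
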